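/- arXiv:1003.0243 — 2 statements merged into one kernel-verified Lean document; each statement's English description precedes it below -/
import Mathlib

section
/- Let λ > 0, γ ≥ 1, σ > 0, τ > 0, d ∈ ℝ, ξ ∈ ℕ, and let B, V be finite sets. Then λ · γ^{-card(B \ V)} · exp(d²τ²/(2(σ² + τ²ξ)(σ² + τ²(ξ+1)))) · √((τ²ξ + σ²)/(τ²(ξ+1) + σ²)) ≤ λ · exp(d²τ²/(2σ²(τ² + σ²))). (That is, the full Papangelou conditional intensity λ_{f₁}λ_{f₂}λ_{f₃}λ_{f₄} of the wavelet posterior at a location with data value d is dominated by the location-specific rate λ^{dom} = λ exp(d²τ²/(2σ²(τ²+σ²))) of equation (5.1), validating the dominating process of the wavelet CFTP algorithm.) -/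
open Real

/-- The full Papangelou conditional intensity `λ_{f₁}λ_{f₂}λ_{f₃}λ_{f₄}` of the
wavelet posterior at a location with data value `d`, `ξ` points, neighbourhood `B`
and covered region `V`, is dominated by the location-specific rate
`λ^{dom} = λ exp(d²τ²/(2σ²(τ²+σ²)))` of equation (5.1). -/
theorem wavelet_posterior_intensity_dominated {β : Type*} [DecidableEq β]
    (lam γ σ τ d : ℝ) (hlam : 0 < lam) (hγ : 1 ≤ γ) (hσ : 0 < σ) (hτ : 0 < τ)
    (ξ : ℕ) (B V : Finset β) :
    lam * γ ^ (-(((B \ V).card : ℝ)))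
        * exp (d ^ 2 * τ ^ 2 /
            (2 * (σ ^ 2 + τ ^ 2 * (ξ : ℝ)) * (σ ^ 2 + τ ^ 2 * ((ξ : ℝ) + 1))))
        * Real.sqrt ((τ ^ 2 * (ξ : ℝ) + σ ^ 2) / (τ ^ 2 * ((ξ : ℝ) + 1) + σ ^ 2))
      ≤ lam * exp (d ^ 2 * τ ^ 2 / (2 * σ ^ 2 * (τ ^ 2 + σ ^ 2))) := by
  have hx : (0 : ℝ) ≤ ξ := ξ.cast_nonneg
  have hs : 0 < σ ^ 2 := by positivity
  have ht : 0 < τ ^ 2 := by positivity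
  have htx : 0 ≤ τ ^ 2 * (ξ : ℝ) := by positivity
  have h₂ : γ ^ (-(((B \ V).card : ℝ))) ≤ 1 :=
    rpow_le_one_of_one_le_of_nonpos hγ (neg_nonpos.mpr (Nat.cast_nonneg _))
  have h₃ : exp (d ^ 2 * τ ^ 2 /
        (2 * (σ ^ 2 + τ ^ 2 * (ξ : ℝ)) * (σ ^ 2 + τ ^ 2 * ((ξ : ℝ) + 1))))
      ≤ exp (d ^ 2 * τ ^ 2 / (2 * σ ^ 2 * (τ ^ 2 + σ ^ 2))) := by
    rw [exp_le_exp]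
    apply div_le_div_of_nonneg_left (by positivity) (by positivity)
    apply mul_le_mul _ _ (by positivity) (by positivity) <;> linarith
  have h₄ : Real.sqrt ((τ ^ 2 * (ξ : ℝ) + σ ^ 2) / (τ ^ 2 * ((ξ : ℝ) + 1) + σ ^ 2)) ≤ 1 := by
    rw [Real.sqrt_le_one, div_le_one (by positivity)]
    linarith
  refine (mul_le_of_le_one_right (by positivity) h₄).trans ?_
  exact mul_le_mul (mul_le_of_le_one_right hlam.le h₂) h₃ (exp_pos _).le hlam.le
end

section
/- Let γ ≥ 1, σ > 0, τ > 0, d ∈ ℝ, ξ ∈ ℕ, let B, V be finite sets, and let M ∈ ℕ satisfy card(B) ≤ M. Then γ^{-M} · √(σ²/(τ² + σ²)) ≤ γ^{-card(B \ V)} · exp(d²τ²/(2(σ² + τ²ξ)(σ² + τ²(ξ+1)))) · √((τ²ξ + σ²)/(τ²(ξ+1) + σ²)). (Hence the thinning probability P(x) = γ^{-M(χ)}√(σ²/(τ²+σ²)) exp(−d̂_x²τ²/(2σ²(τ²+σ²))) used to initialise the lower process never exceeds the normalised conditional intensity λ_p(u;ξ)/λ^{dom}, so the initial lower process is a valid lower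 bound.) -/
open Real

/-- Validity of the initial lower process of the wavelet CFTP algorithm: the
thinning probability `γ^{-M(χ)}√(σ²/(τ²+σ²))` never exceeds the product
`λ_{f₂}λ_{f₃}λ_{f₄}` of per-factor conditional intensities (here `card B ≤ M`). -/
theorem wavelet_lower_process_valid {β : Type*} [DecidableEq β]
    (γ σ τ d : ℝ) (hγ : 1 ≤ γ) (hσ : 0 < σ) (hτ : 0 < τ)
    (ξ : ℕ) (B V : Finset β) (M : ℕ) (hBM : B.card ≤ M) :
    γ ^ (-(M : ℝ)) * Real.sqrt (σ ^ 2 / (τ ^ 2 + σ ^ 2))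
      ≤ γ ^ (-(((B \ V).card : ℝ)))
        * exp (d ^ 2 * τ ^ 2 /
            (2 * (σ ^ 2 + τ ^ 2 * (ξ : ℝ)) * (σ ^ 2 + τ ^ 2 * ((ξ : ℝ) + 1))))
        * Real.sqrt ((τ ^ 2 * (ξ : ℝ) + σ ^ 2) / (τ ^ 2 * ((ξ : ℝ) + 1) + σ ^ 2)) := by
  have h_card : ((B \ V).card : ℝ) ≤ M :=
    mod_cast (Finset.card_le_card Finset.sdiff_subset).trans hBM
  have h_pow : γ ^ (-(M : ℝ)) ≤ γ ^ (-((B \ V).card : ℝ)) :=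
    rpow_le_rpow_of_exponent_le hγ (neg_le_neg h_card)
  have h_exp : 1 ≤ exp (d ^ 2 * τ ^ 2 /
      (2 * (σ ^ 2 + τ ^ 2 * (ξ : ℝ)) * (σ ^ 2 + τ ^ 2 * ((ξ : ℝ) + 1)))) :=
    one_le_exp (by positivity)
  have h_ratio : σ ^ 2 / (τ ^ 2 + σ ^ 2)
      ≤ (τ ^ 2 * (ξ : ℝ) + σ ^ 2) / (τ ^ 2 * ((ξ : ℝ) + 1) + σ ^ 2) := by
    rw [div_le_div_iff₀ (by positivity) (by positivity)]
    have : 0 ≤ τ ^ 2 * τ ^ 2 * (ξ : ℝ) := by positivity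
    linarith
  have h_nonneg : 0 ≤ γ ^ (-((B \ V).card : ℝ)) := by positivity
  exact mul_le_mul (h_pow.trans (le_mul_of_one_le_right h_nonneg h_exp))
    (sqrt_le_sqrt h_ratio) (sqrt_nonneg _) (by positivity)
end
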